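/- arXiv:2204.00798 — 5 statements merged into one kernel-verified Lean document; each statement's English description precedes it below -/
import Mathlib

section
/- Let K be a complex Hilbert space, let A be a von Neumann algebra acting on K (a unital *-subalgebra of the bounded operators B(K) equal to its double commutant), and let γ be a *-algebra automorphism of A with γ∘γ = id (a grading). Assume that the graded center of (A,γ) consists exactly of the complex scalar multiples of the identity. Then the (ungraded) center Z of A is invariant under γ, and exactly one of the following holds: (a) Z consists exactly of the scalar multiples of the identity; or (b) there exists p ∈ A with p* = p, p·p = 1 and γ(p) = −p such that Z = {λ·1 + μ·p : λ, μ ∈ ℂ}, and the map λ·1 + μ·p ↦ (λ+μ, λ−μ) is a *-algebra isomorphism of Z onto ℂ × ℂ carrying the restriction of γ to the swap (z,w) ↦ (w,z). -/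
/-- If `x⋆ x` is a scalar multiple of the identity and `x ≠ 0`, the scalar is the square of a
nonzero real number. -/
theorem exists_real_sq_of_star_mul_self_eq_smul_one {K : Type*} [NormedAddCommGroup K]
    [InnerProductSpace ℂ K] [CompleteSpace K] {x : K →L[ℂ] K} {c : ℂ}
    (h : star x * x = c • 1) (hx : x ≠ 0) : ∃ r : ℝ, r ≠ 0 ∧ c = (r : ℂ) ^ 2 := by
  obtain ⟨v, hv⟩ : ∃ v, x v ≠ 0 := by
    by_contra! H
    exact hx (ContinuousLinearMap.ext H)
  have hv0 : v ≠ 0 := by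
    rintro rfl
    exact hv (map_zero x)
  have hn : (‖v‖ : ℂ) ≠ 0 := by simpa using hv0
  refine ⟨‖x v‖ / ‖v‖, div_ne_zero (norm_ne_zero_iff.2 hv) (norm_ne_zero_iff.2 hv0), ?_⟩
  have h1 : inner ℂ v ((star x * x) v) = inner ℂ (x v) (x v) := by
    rw [ContinuousLinearMap.star_eq_adjoint, mul_apply_eq_comp,
      ContinuousLinearMap.adjoint_inner_right]
  rw [h, smul_apply, one_apply_eq_self, inner_smul_right,
    inner_self_eq_norm_sq_to_K, inner_self_eq_norm_sq_to_K] at h1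
  push_cast
  rw [div_pow, eq_div_iff (pow_ne_zero 2 hn)]
  exact h1

section GradedStarAlgebra

variable {R : Type*} [Ring R] [StarRing R] [Algebra ℂ R]

/-- The image of a central element under an involutive automorphism is central. -/
theorem map_mul_comm_of_involutive (γ : R ≃⋆ₐ[ℂ] R) (hinv : ∀ a, γ (γ a) = a) {z : R}
    (hz : ∀ b, z * b = b * z) (b : R) : γ z * b = b * γ z := by
  have h := congrArg γ (hz (γ b))
  rwa [map_mul, map_mul, hinv] at h

/-- A nonzero central odd element yields a nonzero self-adjoint central odd element. -/
theorem exists_selfAdjoint_odd_central [StarModule ℂ R] (γ : R ≃⋆ₐ[ℂ] R) {y : R} (hy0 : y ≠ 0)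
    (hy : ∀ b, y * b = b * y) (hγ : γ y = -y) :
    ∃ x : R, x ≠ 0 ∧ star x = x ∧ (∀ b, x * b = b * x) ∧ γ x = -x := by
  have hs : ∀ b, star y * b = b * star y := fun b => by
    have h := congrArg star (hy (star b))
    rw [star_mul, star_mul, star_star] at h
    exact h.symm
  have hγs : γ (star y) = -star y := by rw [map_star, hγ, star_neg]
  by_cases h : y + star y = 0
  · refine ⟨Complex.I • y, smul_ne_zero Complex.I_ne_zero hy0, ?_, fun b => ?_, ?_⟩
    · rw [star_smul, eq_neg_of_add_eq_zero_right h]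
      simp
    · rw [smul_mul_assoc, hy, mul_smul_comm]
    · rw [map_smul, hγ, smul_neg]
  · refine ⟨y + star y, h, ?_, fun b => ?_, ?_⟩
    · rw [star_add, star_star, add_comm]
    · rw [add_mul, hy, hs, mul_add]
    · rw [map_add, hγ, hγs, neg_add]

/-- If even central elements are scalars and squares `x⋆ x` that are scalar are positive, then a
nonzero central odd element yields a self-adjoint odd central symmetry. -/
theorem exists_odd_central_symmetry [StarModule ℂ R] (γ : R ≃⋆ₐ[ℂ] R)
    (hpos : ∀ (x : R) (c : ℂ), star x * x = c • 1 → x ≠ 0 → ∃ r : ℝ, r ≠ 0 ∧ c = (r : ℂ) ^ 2)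
    (heven : ∀ z : R, (∀ b, z * b = b * z) → γ z = z → ∃ l : ℂ, z = l • 1)
    {y : R} (hy0 : y ≠ 0) (hy : ∀ b, y * b = b * y) (hγ : γ y = -y) :
    ∃ p : R, star p = p ∧ p * p = 1 ∧ (∀ b, p * b = b * p) ∧ γ p = -p := by
  obtain ⟨x, hx0, hsx, hx, hγx⟩ := exists_selfAdjoint_odd_central γ hy0 hy hγ
  obtain ⟨c, hc⟩ := heven (x * x) (fun b => by rw [mul_assoc, hx b, ← mul_assoc, hx b, mul_assoc])
    (by rw [map_mul, hγx, neg_mul_neg])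
  obtain ⟨r, hr, rfl⟩ := hpos x c (by rw [hsx, hc]) hx0
  have hr' : (r : ℂ) ≠ 0 := by exact_mod_cast hr
  refine ⟨(r : ℂ)⁻¹ • x, ?_, ?_, fun b => ?_, ?_⟩
  · rw [star_smul, hsx]
    simp
  · rw [smul_mul_smul_comm, hc, smul_smul, ← sq, ← mul_pow, inv_mul_cancel₀ hr', one_pow, one_smul]
  · rw [smul_mul_assoc, hx, mul_smul_comm]
  · rw [map_smul, hγx, smul_neg]

/-- If even central elements are scalars, then every central element is a combination of `1`
and a given central odd symmetry. -/
theorem exists_eq_smul_one_add_smul_of_central (γ : R ≃⋆ₐ[ℂ] R) (hinv : ∀ a, γ (γ a) = a)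
    (heven : ∀ z : R, (∀ b, z * b = b * z) → γ z = z → ∃ l : ℂ, z = l • 1)
    {p : R} (hpp : p * p = 1) (hp : ∀ b, p * b = b * p) (hγ : γ p = -p)
    {z : R} (hz : ∀ b, z * b = b * z) : ∃ l m : ℂ, z = l • 1 + m • p := by
  have hγz := map_mul_comm_of_involutive γ hinv hz
  obtain ⟨l, hl⟩ := heven (z + γ z) (fun b => by rw [add_mul, hz, hγz, mul_add])
    (by rw [map_add, hinv, add_comm])
  obtain ⟨m, hm⟩ := heven ((z - γ z) * p)
    (fun b => by rw [mul_assoc, hp b, ← mul_assoc, sub_mul, hz, hγz, ← mul_sub, mul_assoc])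
    (by rw [map_mul, map_sub, hinv, hγ, mul_neg, ← neg_mul, neg_sub])
  have hm' : z - γ z = m • p := by
    rw [← mul_one (z - γ z), ← hpp, ← mul_assoc, hm, smul_mul_assoc, one_mul]
  refine ⟨2⁻¹ * l, 2⁻¹ * m, ?_⟩
  rw [mul_smul, mul_smul, ← hl, ← hm']
  module

/-- An odd element `p` with `p * p = 1` in a nontrivial algebra is linearly independent of `1`. -/
theorem smul_one_add_smul_injective [Nontrivial R] (γ : R ≃⋆ₐ[ℂ] R) {p : R}
    (hpp : p * p = 1) (hγ : γ p = -p) :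
    Function.Injective (fun lm : ℂ × ℂ => lm.1 • (1 : R) + lm.2 • p) := by
  have key : ∀ l m : ℂ, l • (1 : R) + m • p = 0 → l = 0 ∧ m = 0 := by
    intro l m h
    have h' : l • (1 : R) - m • p = 0 := by
      have := congrArg γ h
      rwa [map_add, map_smul, map_smul, map_one, hγ, map_zero, smul_neg, ← sub_eq_add_neg] at this
    have hp0 : p ≠ 0 := by
      rintro rfl
      simp at hpp
    have hl : (2 * l) • (1 : R) = 0 := by
      rw [show (2 * l) • (1 : R) = l • 1 + m • p + (l • 1 - m • p) by module, h, h', add_zero]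
    have hm : (2 * m) • p = 0 := by
      rw [show (2 * m) • p = l • 1 + m • p - (l • 1 - m • p) by module, h, h', sub_zero]
    simpa [hp0] using And.intro hl hm
  rintro ⟨l, m⟩ ⟨l', m'⟩ h
  obtain ⟨h1, h2⟩ := key (l - l') (m - m') (by
    have h' : l • (1 : R) + m • p = l' • 1 + m' • p := h
    rw [sub_smul, sub_smul, sub_add_sub_comm, h', sub_self])
  rw [sub_eq_zero.1 h1, sub_eq_zero.1 h2]

end GradedStarAlgebra


/-- Let `A` be a von Neumann algebra acting on a complex Hilbert space `K`,
and `γ` a grading (involutive ⋆-algebra automorphism) of `A` whose graded center consists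
exactly of the scalar multiples of the identity.  Then the ungraded center is `γ`-invariant
and exactly one of the following holds: (a) the center consists exactly of the scalars, or
(b) there is a self-adjoint odd symmetry `p` such that the center is `{λ•1 + μ•p}` and
`λ•1 + μ•p ↦ (λ+μ, λ-μ)` is a ⋆-algebra isomorphism onto `ℂ × ℂ` carrying `γ` to the swap. -/
theorem stmt_0 {K : Type*} [NormedAddCommGroup K] [InnerProductSpace ℂ K] [CompleteSpace K]
    (A : VonNeumannAlgebra K)
    (γ : A.toStarSubalgebra ≃⋆ₐ[ℂ] A.toStarSubalgebra)
    (hinv : ∀ a, γ (γ a) = a)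
    (hgc : ∀ a : A.toStarSubalgebra,
      ((∀ b, ((2 : ℂ)⁻¹ • (a + γ a)) * b = b * ((2 : ℂ)⁻¹ • (a + γ a))) ∧
       (∀ b, γ b = b → ((2 : ℂ)⁻¹ • (a - γ a)) * b = b * ((2 : ℂ)⁻¹ • (a - γ a))) ∧
       (∀ b, γ b = -b → ((2 : ℂ)⁻¹ • (a - γ a)) * b = -(b * ((2 : ℂ)⁻¹ • (a - γ a)))))
      ↔ ∃ l : ℂ, a = l • 1) :
    (∀ z : A.toStarSubalgebra, (∀ b, z * b = b * z) → ∀ b, γ z * b = b * γ z) ∧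
    Xor'
      (∀ z : A.toStarSubalgebra, (∀ b, z * b = b * z) → ∃ l : ℂ, z = l • 1)
      (∃ p : A.toStarSubalgebra, star p = p ∧ p * p = 1 ∧ γ p = -p ∧
        (∀ z, (∀ b, z * b = b * z) ↔ ∃ l m : ℂ, z = l • 1 + m • p) ∧
        Function.Injective (fun lm : ℂ × ℂ => lm.1 • (1 : A.toStarSubalgebra) + lm.2 • p) ∧
        (∀ l m l' m' : ℂ,
          (l • (1 : A.toStarSubalgebra) + m • p) * (l' • 1 + m' • p)
            = (l * l' + m * m') • 1 + (l * m' + m * l') • p) ∧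
        (∀ l m : ℂ, star (l • (1 : A.toStarSubalgebra) + m • p)
            = (starRingEnd ℂ l) • 1 + (starRingEnd ℂ m) • p) ∧
        (∀ l m : ℂ, γ (l • (1 : A.toStarSubalgebra) + m • p) = l • 1 - m • p)) := by
  have heven : ∀ z : A.toStarSubalgebra, (∀ b, z * b = b * z) → γ z = z →
      ∃ l : ℂ, z = l • 1 := by
    intro z hz hγ
    refine (hgc z).1 ⟨fun b => ?_, fun b _ => ?_, fun b _ => ?_⟩
    · rw [hγ, smul_mul_assoc, mul_smul_comm, add_mul, mul_add, hz]
    · simp [hγ]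
    · simp [hγ]
  have hpos : ∀ (x : A.toStarSubalgebra) (c : ℂ), star x * x = c • 1 → x ≠ 0 →
      ∃ r : ℝ, r ≠ 0 ∧ c = (r : ℂ) ^ 2 := fun x c h hx =>
    exists_real_sq_of_star_mul_self_eq_smul_one (x := (x : K →L[ℂ] K))
      (congrArg Subtype.val h) (fun h0 => hx (Subtype.ext h0))
  refine ⟨fun z hz => map_mul_comm_of_involutive γ hinv hz, ?_⟩
  by_cases ha : ∀ z : A.toStarSubalgebra, (∀ b, z * b = b * z) → ∃ l : ℂ, z = l • 1
  · refine Or.inl ⟨ha, ?_⟩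
    rintro ⟨p, -, -, -, hZ, hinj, -⟩
    obtain ⟨l, hl⟩ := ha p ((hZ p).2 ⟨0, 1, by simp⟩)
    have h := @hinj (l, 0) (0, 1) (by simpa using hl.symm)
    simp at h
  · refine Or.inr ⟨?_, ha⟩
    push Not at ha
    obtain ⟨z, hz, hns⟩ := ha
    have hγz := map_mul_comm_of_involutive γ hinv hz
    have hy0 : z - γ z ≠ 0 := fun h => by
      obtain ⟨l, hl⟩ := heven z hz (sub_eq_zero.1 h).symm
      exact hns l hl
    have : Nontrivial A.toStarSubalgebra := ⟨_, _, hy0⟩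
    obtain ⟨p, hsp, hpp, hp, hγp⟩ := exists_odd_central_symmetry γ hpos heven hy0
      (fun b => by rw [sub_mul, mul_sub, hz, hγz]) (by rw [map_sub, hinv, neg_sub])
    refine ⟨p, hsp, hpp, hγp, fun w => ⟨fun hw =>
      exists_eq_smul_one_add_smul_of_central γ hinv heven hpp hp hγp hw, ?_⟩,
      smul_one_add_smul_injective γ hpp hγp, fun l m l' m' => ?_, fun l m => ?_, fun l m => ?_⟩
    · rintro ⟨l, m, rfl⟩ b
      simp only [add_mul, mul_add, smul_mul_assoc, mul_smul_comm, one_mul, mul_one, hp b]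
    · simp only [add_mul, mul_add, smul_mul_smul_comm, one_mul, mul_one, hpp]
      module
    · rw [star_add, star_smul, star_smul, hsp, star_one]
      rfl
    · rw [map_add, map_smul, map_smul, map_one, hγp, smul_neg, ← sub_eq_add_neg]
end

section
/- Let H be a nonzero complex Hilbert space and let γ be a *-algebra automorphism of B(H) with γ∘γ = id. Then there exists a unitary operator Γ ∈ B(H) with Γ* = Γ and Γ∘Γ = 1 such that γ(a) = Γ∘a∘Γ for all a ∈ B(H). -/
/-- Every unimodular complex number is the square of a unimodular complex number. -/
theorem Complex.exists_unitary_mul_self (α : unitary ℂ) : ∃ β : unitary ℂ, β * β = α := by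
  obtain ⟨z, hz⟩ := IsAlgClosed.exists_eq_mul_self (α : ℂ)
  have hα : ‖(α : ℂ)‖ = 1 := CStarRing.norm_coe_unitary α
  have hnorm : ‖z‖ = 1 := by
    rw [hz, norm_mul] at hα
    nlinarith [norm_nonneg z]
  refine ⟨⟨z, ?_⟩, Subtype.ext hz.symm⟩
  rw [Unitary.mem_iff_self_mul_star]
  simp [Complex.mul_conj, Complex.normSq_eq_norm_sq, hnorm]

/-- Every involutive ⋆-algebra automorphism of `B(H)`, `H` a nonzero complex
Hilbert space, is conjugation by a self-adjoint unitary `Γ` (with `Γ ∘ Γ = 1`). -/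
theorem stmt_3 {H : Type*} [NormedAddCommGroup H] [InnerProductSpace ℂ H] [CompleteSpace H]
    [Nontrivial H] (γ : (H →L[ℂ] H) ≃⋆ₐ[ℂ] (H →L[ℂ] H)) (hinv : ∀ a, γ (γ a) = a) :
    ∃ Γ : H →L[ℂ] H, Γ ∈ unitary (H →L[ℂ] H) ∧ star Γ = Γ ∧ Γ * Γ = 1 ∧
      ∀ a, γ a = Γ * a * Γ := by
  obtain ⟨U, hU⟩ := γ.eq_linearIsometryEquivConjStarAlgEquiv (map_continuous γ)
  obtain ⟨α, hα⟩ : ∃ α : unitary ℂ, LinearIsometryEquiv.refl ℂ H = α • U.trans U := by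
    rw [← LinearIsometryEquiv.conjStarAlgEquiv_ext_iff,
      LinearIsometryEquiv.conjStarAlgEquiv_trans, ← hU]
    ext1 a
    exact (hinv a).symm
  obtain ⟨β, hβ⟩ := Complex.exists_unitary_mul_self α
  set V : H ≃ₗᵢ[ℂ] H := β • U with hV
  have hγ : γ = V.conjStarAlgEquiv :=
    hU.trans (((LinearIsometryEquiv.conjStarAlgEquiv_ext_iff V U).mpr ⟨β, hV⟩).symm)
  have hVV (x : H) : V (V x) = x := by
    have hx : x = α • U (U x) := congr($hα x)
    have hβx : V (V x) = β • U (β • U x) := rfl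
    rw [hβx, show U (β • U x) = β • U (U x) from map_smul U (β : ℂ) (U x), smul_smul, hβ, ← hx]
  have hsymm : V.symm = V := by
    ext x
    rw [LinearIsometryEquiv.symm_apply_eq, hVV]
  have hsq : (V : H →L[ℂ] H) * (V : H →L[ℂ] H) = 1 := ContinuousLinearMap.ext hVV
  have hstar : star (V : H →L[ℂ] H) = V := by
    rw [ContinuousLinearMap.star_eq_adjoint, LinearIsometryEquiv.adjoint_eq_symm, hsymm]
  refine ⟨V, by simp [Unitary.mem_iff, hstar, hsq], hstar, hsq, fun a ↦ ?_⟩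
  ext x
  rw [hγ, LinearIsometryEquiv.conjStarAlgEquiv_apply_apply, hsymm]
  rfl
end

section
/- Let H and K be nonzero complex Hilbert spaces and let γ be a *-algebra automorphism of the product *-algebra B(H) × B(K) with γ∘γ = id which interchanges the two factors, i.e., γ maps B(H) × {0} into {0} × B(K). Then there exists a unitary isomorphism x : H → K such that γ(a,b) = (x* ∘ b ∘ x, x ∘ a ∘ x*) for all a ∈ B(H), b ∈ B(K). -/
/-- A central idempotent of `B(K)` is trivial. -/
lemma ContinuousLinearMap.eq_zero_or_eq_one_of_central_idempotent {K : Type*}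
    [NormedAddCommGroup K] [InnerProductSpace ℂ K] {p : K →L[ℂ] K}
    (hp : p * p = p) (hc : ∀ b, b * p = p * b) : p = 0 ∨ p = 1 := by
  obtain ⟨c, rfl⟩ : ∃ c : ℂ, algebraMap ℂ (K →L[ℂ] K) c = p := by
    obtain ⟨c, h⟩ := (Algebra.IsCentral.mem_center_iff ℂ).mp
      ((Subalgebra.mem_center_iff (R := ℂ)).mpr hc)
    exact ⟨c, h.symm⟩
  rw [Algebra.algebraMap_eq_smul_one] at hp ⊢
  have h : (c * (c - 1)) • (1 : K →L[ℂ] K) = 0 := by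
    rw [mul_sub, sub_smul, mul_one, sub_eq_zero]
    simpa [smul_smul] using hp
  rcases smul_eq_zero.mp h with h | h
  · rcases mul_eq_zero.mp h with h | h
    · simp [h]
    · simp [sub_eq_zero.mp h]
  · simp [h]

/-- An automorphism of `B(H) × B(K)` mapping the first factor into the second one maps the unit
of the first factor to the unit of the second one. -/
lemma StarAlgEquiv.map_one_zero_of_interchange {H K : Type*} [NormedAddCommGroup H]
    [InnerProductSpace ℂ H] [CompleteSpace H] [NormedAddCommGroup K] [InnerProductSpace ℂ K]
    [CompleteSpace K] [Nontrivial H]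
    (γ : ((H →L[ℂ] H) × (K →L[ℂ] K)) ≃⋆ₐ[ℂ] ((H →L[ℂ] H) × (K →L[ℂ] K)))
    (hswap : ∀ a : H →L[ℂ] H, (γ (a, 0)).1 = 0) : γ (1, 0) = (0, 1) := by
  have hp : (γ (1, 0)).2 * (γ (1, 0)).2 = (γ (1, 0)).2 := by
    rw [← Prod.snd_mul, ← map_mul]; simp
  have hc : ∀ b, b * (γ (1, 0)).2 = (γ (1, 0)).2 * b := fun b ↦ by
    obtain ⟨x, hx⟩ : ∃ x, γ x = (0, b) := γ.surjective (0, b)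
    have h : γ x * γ (1, 0) = γ (1, 0) * γ x := by
      rw [← map_mul, ← map_mul]; congr 1; ext1 <;> simp
    rw [hx] at h
    exact congr(($h).2)
  rcases ContinuousLinearMap.eq_zero_or_eq_one_of_central_idempotent hp hc with h | h
  · have h0 : γ (1, 0) = γ 0 := by
      rw [map_zero]; exact Prod.ext (hswap 1) h
    exact absurd congr(($(γ.injective h0)).1) one_ne_zero
  · exact Prod.ext (hswap 1) h


/-- An involutive ⋆-algebra automorphism of `B(H) × B(K)` interchanging the two
factors is induced by a unitary isomorphism `x : H → K`, via
`γ(a,b) = (x⁻¹ ∘ b ∘ x, x ∘ a ∘ x⁻¹)` (the adjoint of the surjective linear isometry `x`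
being its inverse). -/
theorem stmt_4 {H K : Type*} [NormedAddCommGroup H] [InnerProductSpace ℂ H] [CompleteSpace H]
    [NormedAddCommGroup K] [InnerProductSpace ℂ K] [CompleteSpace K]
    [Nontrivial H] [Nontrivial K]
    (γ : ((H →L[ℂ] H) × (K →L[ℂ] K)) ≃⋆ₐ[ℂ] ((H →L[ℂ] H) × (K →L[ℂ] K)))
    (hinv : ∀ x, γ (γ x) = x)
    (hswap : ∀ a : H →L[ℂ] H, (γ (a, 0)).1 = 0) :
    ∃ x : H ≃ₗᵢ[ℂ] K, ∀ (a : H →L[ℂ] H) (b : K →L[ℂ] K),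
      (∀ v : H, (γ (a, b)).1 v = x.symm (b (x v))) ∧
      (∀ w : K, (γ (a, b)).2 w = x (a (x.symm w))) := by
  have h10 := γ.map_one_zero_of_interchange hswap
  have h01 : γ (0, 1) = (1, 0) := by rw [← h10, hinv]
  have hswap' : ∀ b : K →L[ℂ] K, (γ (0, b)).2 = 0 := fun b ↦ by
    have h : γ (0, b) = γ (0, 1) * γ (0, b) := by rw [← map_mul]; simp
    rw [h, h01]; simp
  have hl : ∀ a : H →L[ℂ] H, γ (a, 0) = (0, (γ (a, 0)).2) := fun a ↦ Prod.ext (hswap a) rfl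
  have hr : ∀ b : K →L[ℂ] K, γ (0, b) = ((γ (0, b)).1, 0) := fun b ↦ Prod.ext rfl (hswap' b)
  let φ : (H →L[ℂ] H) ≃⋆ₐ[ℂ] (K →L[ℂ] K) :=
    { toFun := fun a ↦ (γ (a, 0)).2
      invFun := fun b ↦ (γ (0, b)).1
      left_inv := fun a ↦ by simp only [← hl, hinv]
      right_inv := fun b ↦ by simp only [← hr, hinv]
      map_mul' := fun a b ↦ by rw [← Prod.snd_mul, ← map_mul]; simp
      map_add' := fun a b ↦ by rw [← Prod.snd_add, ← map_add]; simp
      map_star' := fun a ↦ by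
        have h : γ (star (a, 0)) = star (γ (a, 0)) := γ.map_star' (a, 0)
        rw [← Prod.snd_star, ← h, Prod.star_def]; simp
      map_smul' := fun c a ↦ by rw [← Prod.smul_snd, ← map_smul]; simp }
  obtain ⟨U, hU⟩ := φ.eq_linearIsometryEquivConjStarAlgEquiv (map_continuous φ)
  have hφ : ∀ a, (γ (a, 0)).2 = U.conjStarAlgEquiv a := fun a ↦ congr($hU a)
  have hψ : ∀ b, (γ (0, b)).1 = U.conjStarAlgEquiv.symm b := fun b ↦ congr(($hU).symm b)
  refine ⟨U, fun a b ↦ ?_⟩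
  have hab : γ (a, b) = ((γ (0, b)).1, (γ (a, 0)).2) := by
    have h : γ (a, b) = γ (a, 0) + γ (0, b) := by rw [← map_add]; simp
    rw [h, hl a, hr b]; simp
  rw [hab, hφ, hψ]
  exact ⟨fun v ↦ rfl, fun w ↦ rfl⟩
end

section
/- Let H be a nonzero complex Hilbert space, let Γ = diag(1,−1) on the Hilbert direct sum H ⊕ H, and equip B(H ⊕ H) with the grading γ(a) = Γ∘a∘Γ. Then: (a) for every *-algebra automorphism φ of B(H ⊕ H) satisfying φ∘γ = γ∘φ there exists a unitary U ∈ B(H ⊕ H) with either Γ∘U∘Γ = U or Γ∘U∘Γ = −U, such that φ(a) = U∘a∘U* for all a; (b) this U is unique up to multiplication by a complex scalar of modulus one; consequently the sign ε(φ) ∈ {1,−1} determined by Γ∘U∘Γ = ε(φ)·U is well defined, and φ ↦ ε(φ) is a group homomorphism from the group of grading-preserving *-automorphisms of B(H ⊕ H) onto {1,−1}, which is split by sending −1 to the automorphism of conjugation by the unitary Γ_odd(x,y) = (y,x). -/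
set_option maxHeartbeats 1000000
set_option synthInstance.maxHeartbeats 400000

noncomputable section

variable (H : Type*) [NormedAddCommGroup H] [InnerProductSpace ℂ H]

/-- The identification of the Hilbert direct sum `H ⊕ H` (modelled as `WithLp 2 (H × H)`,
which carries the inner product `⟪(x₁,y₁),(x₂,y₂)⟫ = ⟪x₁,x₂⟫ + ⟪y₁,y₂⟫`) with `H × H`. -/
def hilbertSumEquiv : WithLp 2 (H × H) ≃L[ℂ] H × H :=
  WithLp.prodContinuousLinearEquiv 2 ℂ H H

/-- The grading operator `Γ = diag(1, -1)`, i.e. `Γ(x,y) = (x,-y)`, on `H ⊕ H`. -/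
def GammaEv : WithLp 2 (H × H) →L[ℂ] WithLp 2 (H × H) :=
  (hilbertSumEquiv H).symm.toContinuousLinearMap ∘L
    (ContinuousLinearMap.prodMap (1 : H →L[ℂ] H) (-(1 : H →L[ℂ] H))) ∘L
      (hilbertSumEquiv H).toContinuousLinearMap

/-- The odd unitary `Γ_odd(x,y) = (y,x)` on `H ⊕ H`. -/
def GammaOdd : WithLp 2 (H × H) →L[ℂ] WithLp 2 (H × H) :=
  (hilbertSumEquiv H).symm.toContinuousLinearMap ∘L
    ((ContinuousLinearMap.snd ℂ H H).prod (ContinuousLinearMap.fst ℂ H H)) ∘L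
      (hilbertSumEquiv H).toContinuousLinearMap


/-- The algebra of bounded operators on the Hilbert direct sum `H ⊕ H`. -/
abbrev BHH (H : Type*) [NormedAddCommGroup H] [InnerProductSpace ℂ H] :=
  WithLp 2 (H × H) →L[ℂ] WithLp 2 (H × H)

variable {H}

/-- A ⋆-algebra automorphism `φ` of `B(H ⊕ H)` is grading-preserving when it commutes with
the grading `γ(a) = Γ ∘ a ∘ Γ`. -/
def GradingPreserving [CompleteSpace H]
    (φ : (WithLp 2 (H × H) →L[ℂ] WithLp 2 (H × H)) ≃⋆ₐ[ℂ]
          (WithLp 2 (H × H) →L[ℂ] WithLp 2 (H × H))) : Prop :=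
  ∀ a, φ (GammaEv H * a * GammaEv H) = GammaEv H * φ a * GammaEv H

/-- `U` is a unitary implementing the automorphism `φ` of `B(H ⊕ H)`. -/
def Implements [CompleteSpace H]
    (φ : (WithLp 2 (H × H) →L[ℂ] WithLp 2 (H × H)) ≃⋆ₐ[ℂ]
          (WithLp 2 (H × H) →L[ℂ] WithLp 2 (H × H)))
    (U : WithLp 2 (H × H) →L[ℂ] WithLp 2 (H × H)) : Prop :=
  U ∈ unitary (WithLp 2 (H × H) →L[ℂ] WithLp 2 (H × H)) ∧ ∀ a, φ a = U * a * star U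

lemma GammaEv_apply (x : WithLp 2 (H × H)) :
    GammaEv H x = WithLp.toLp 2 (x.fst, -x.snd) := rfl

lemma GammaOdd_apply (x : WithLp 2 (H × H)) :
    GammaOdd H x = WithLp.toLp 2 (x.snd, x.fst) := rfl

lemma GammaEv_mul_self : GammaEv H * GammaEv H = 1 := by
  ext x
  change GammaEv H (GammaEv H x) = x
  rw [GammaEv_apply, GammaEv_apply]
  exact congrArg (WithLp.toLp 2) (Prod.ext rfl (neg_neg _))

lemma GammaOdd_mul_self : GammaOdd H * GammaOdd H = 1 := by
  ext x
  rfl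

lemma GammaEv_mul_GammaOdd_mul_GammaEv : GammaEv H * GammaOdd H * GammaEv H = -GammaOdd H := by
  ext x
  change GammaEv H (GammaOdd H (GammaEv H x)) = -GammaOdd H x
  simp [GammaEv_apply, GammaOdd_apply, ← WithLp.toLp_neg]

lemma GammaEv_conj_conj (a : BHH H) :
    GammaEv H * (GammaEv H * a * GammaEv H) * GammaEv H = a := by
  calc _ = (GammaEv H * GammaEv H) * a * (GammaEv H * GammaEv H) := by simp only [mul_assoc]
    _ = a := by rw [GammaEv_mul_self, one_mul, mul_one]

lemma GammaEv_conj_mul (a b : BHH H) :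
    GammaEv H * (a * b) * GammaEv H =
      (GammaEv H * a * GammaEv H) * (GammaEv H * b * GammaEv H) := by
  calc _ = GammaEv H * a * 1 * b * GammaEv H := by simp only [mul_assoc, one_mul]
    _ = _ := by rw [← GammaEv_mul_self]; simp only [mul_assoc]

lemma neg_mul_mul_neg_eq {R : Type*} [Ring R] (u a : R) : -u * a * -u = u * a * u := by
  rw [neg_mul, neg_mul_neg]

section Complete

variable [CompleteSpace H]

lemma star_GammaEv : star (GammaEv H) = GammaEv H := by
  rw [ContinuousLinearMap.star_eq_adjoint, eq_comm, ContinuousLinearMap.eq_adjoint_iff]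
  intro x y
  simp [GammaEv_apply, WithLp.prod_inner_apply]

lemma star_GammaOdd : star (GammaOdd H) = GammaOdd H := by
  rw [ContinuousLinearMap.star_eq_adjoint, eq_comm, ContinuousLinearMap.eq_adjoint_iff]
  intro x y
  simp [GammaOdd_apply, WithLp.prod_inner_apply, add_comm]

lemma GammaEv_mem_unitary : GammaEv H ∈ unitary (BHH H) := by
  simp [Unitary.mem_iff, star_GammaEv, GammaEv_mul_self]

lemma GammaOdd_mem_unitary : GammaOdd H ∈ unitary (BHH H) := by
  simp [Unitary.mem_iff, star_GammaOdd, GammaOdd_mul_self]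

lemma exists_implements (φ : BHH H ≃⋆ₐ[ℂ] BHH H) : ∃ U : BHH H, Implements φ U := by
  obtain ⟨e, he⟩ := StarAlgEquiv.eq_linearIsometryEquivConjStarAlgEquiv φ
    (StarAlgEquiv.isometry φ).continuous
  refine ⟨_, (Unitary.linearIsometryEquiv.symm e).2, fun a => ?_⟩
  rw [he, ← Unitary.conjStarAlgAut_symm_unitaryLinearIsometryEquiv, Unitary.conjStarAlgAut_apply]

lemma Implements.exists_smul_eq {φ : BHH H ≃⋆ₐ[ℂ] BHH H} {U V : BHH H}
    (hU : Implements φ U) (hV : Implements φ V) : ∃ c : ℂ, ‖c‖ = 1 ∧ V = c • U := by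
  have h : Unitary.conjStarAlgAut ℂ (BHH H) ⟨V, hV.1⟩ =
      Unitary.conjStarAlgAut ℂ (BHH H) ⟨U, hU.1⟩ := by
    ext1 a
    rw [Unitary.conjStarAlgAut_apply, Unitary.conjStarAlgAut_apply]
    exact (hV.2 a).symm.trans (hU.2 a)
  obtain ⟨α, hα⟩ := (Unitary.conjStarAlgAut_ext_iff' _ _).1 h
  exact ⟨α, CStarRing.norm_of_mem_unitary α.2, congrArg Subtype.val hα⟩

lemma Implements.trans {φ ψ : BHH H ≃⋆ₐ[ℂ] BHH H} {U V : BHH H}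
    (hU : Implements φ U) (hV : Implements ψ V) : Implements (ψ.trans φ) (U * V) := by
  refine ⟨mul_mem hU.1 hV.1, fun a => ?_⟩
  change φ (ψ a) = _
  rw [hV.2, hU.2, star_mul]
  simp only [mul_assoc]

lemma Implements.ne_zero [Nontrivial H] {φ : BHH H ≃⋆ₐ[ℂ] BHH H} {U : BHH H}
    (hU : Implements φ U) : U ≠ 0 := by
  rintro rfl
  have h := hU.1.1
  rw [mul_zero] at h
  exact zero_ne_one h

lemma GradingPreserving.trans {φ ψ : BHH H ≃⋆ₐ[ℂ] BHH H}
    (hφ : GradingPreserving φ) (hψ : GradingPreserving ψ) : GradingPreserving (ψ.trans φ) := by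
  intro a
  change φ (ψ _) = GammaEv H * φ (ψ a) * GammaEv H
  rw [hψ, hφ]

lemma GradingPreserving.implements_conj {φ : BHH H ≃⋆ₐ[ℂ] BHH H} (hφ : GradingPreserving φ)
    {U : BHH H} (hU : Implements φ U) : Implements φ (GammaEv H * U * GammaEv H) := by
  refine ⟨mul_mem (mul_mem GammaEv_mem_unitary hU.1) GammaEv_mem_unitary, fun a => ?_⟩
  calc φ a = GammaEv H * φ (GammaEv H * a * GammaEv H) * GammaEv H := by
        rw [hφ, GammaEv_conj_conj]
    _ = _ := by
        rw [hU.2, star_mul, star_mul, star_GammaEv]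
        simp only [mul_assoc]

/-- All unitaries implementing a grading-preserving automorphism have the same parity. -/
lemma GradingPreserving.exists_sign [Nontrivial H] {φ : BHH H ≃⋆ₐ[ℂ] BHH H}
    (hφ : GradingPreserving φ) :
    ∃ s : ℂ, (s = 1 ∨ s = -1) ∧
      ∀ U : BHH H, Implements φ U → GammaEv H * U * GammaEv H = s • U := by
  obtain ⟨U, hU⟩ := exists_implements φ
  obtain ⟨s, -, hs⟩ := hU.exists_smul_eq (hφ.implements_conj hU)
  refine ⟨s, ?_, fun V hV => ?_⟩
  · have h : (s * s) • U = (1 : ℂ) • U := by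
      rw [mul_smul, ← hs, one_smul, ← smul_mul_assoc, ← mul_smul_comm, ← hs, GammaEv_conj_conj]
    exact mul_self_eq_one_iff.1 (smul_left_injective ℂ hU.ne_zero h)
  · obtain ⟨c, -, rfl⟩ := hU.exists_smul_eq hV
    rw [mul_smul_comm, smul_mul_assoc, hs, smul_comm]

end Complete

/-- (a) every grading-preserving ⋆-automorphism `φ` of `B(H ⊕ H)` is implemented
by a unitary `U` which is either even (`ΓUΓ = U`) or odd (`ΓUΓ = -U`); (b) such a `U` is
unique up to a scalar of modulus one, so the sign `ε(φ)` with `ΓUΓ = ε(φ)·U` is well defined,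
takes values in `{1,-1}`, is multiplicative (`ε(φ∘ψ) = ε(φ)·ε(ψ)`), and is split onto
`{1,-1}` by the involutive automorphism of conjugation by `Γ_odd(x,y) = (y,x)`, which is
grading-preserving and has sign `-1`. -/
theorem stmt_6 [CompleteSpace H] [Nontrivial H] :
    (∀ φ : BHH H ≃⋆ₐ[ℂ] BHH H, GradingPreserving φ →
      ∃ U : BHH H, Implements φ U ∧
        (GammaEv H * U * GammaEv H = U ∨ GammaEv H * U * GammaEv H = -U)) ∧
    (∀ (φ : BHH H ≃⋆ₐ[ℂ] BHH H) (U V : BHH H), GradingPreserving φ → Implements φ U → Implements φ V →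
      ∃ c : ℂ, ‖c‖ = 1 ∧ V = c • U) ∧
    (∃ ε : (BHH H ≃⋆ₐ[ℂ] BHH H) → ℂ,
      (∀ (φ : BHH H ≃⋆ₐ[ℂ] BHH H), GradingPreserving φ → ∀ U : BHH H, Implements φ U →
        GammaEv H * U * GammaEv H = ε φ • U) ∧
      (∀ φ : BHH H ≃⋆ₐ[ℂ] BHH H, GradingPreserving φ → ε φ = 1 ∨ ε φ = -1) ∧
      (∀ φ ψ : BHH H ≃⋆ₐ[ℂ] BHH H, GradingPreserving φ → GradingPreserving ψ →
        ε (ψ.trans φ) = ε φ * ε ψ) ∧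
      (∃ φodd : BHH H ≃⋆ₐ[ℂ] BHH H, GradingPreserving φodd ∧
        (∀ a, φodd a = GammaOdd H * a * star (GammaOdd H)) ∧
        ε φodd = -1 ∧ ∀ a, φodd (φodd a) = a)) := by
  choose! ε hε hεU using
    fun (φ : BHH H ≃⋆ₐ[ℂ] BHH H) (hφ : GradingPreserving φ) => hφ.exists_sign
  refine ⟨fun φ hφ => ?_, fun φ U V _ hU hV => hU.exists_smul_eq hV,
    ε, hεU, hε, fun φ ψ hφ hψ => ?_, ?_⟩
  · obtain ⟨U, hU⟩ := exists_implements φ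
    refine ⟨U, hU, ?_⟩
    rw [hεU φ hφ U hU]
    rcases hε φ hφ with h | h
    · exact .inl (by rw [h, one_smul])
    · exact .inr (by rw [h]; exact neg_one_smul ℂ U)
  · obtain ⟨U, hU⟩ := exists_implements φ
    obtain ⟨V, hV⟩ := exists_implements ψ
    have hUV := hU.trans hV
    refine smul_left_injective ℂ hUV.ne_zero ?_
    change ε (ψ.trans φ) • (U * V) = (ε φ * ε ψ) • (U * V)
    rw [← hεU _ (hφ.trans hψ) _ hUV, GammaEv_conj_mul, hεU φ hφ U hU, hεU ψ hψ V hV,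
      smul_mul_smul_comm]
  · let φodd := Unitary.conjStarAlgAut ℂ (BHH H) ⟨GammaOdd H, GammaOdd_mem_unitary⟩
    have himp : Implements φodd (GammaOdd H) := ⟨GammaOdd_mem_unitary, fun a => rfl⟩
    have hgr : GradingPreserving φodd := fun a => by
      rw [himp.2, himp.2, GammaEv_conj_mul, GammaEv_conj_mul, star_GammaOdd,
        GammaEv_mul_GammaOdd_mul_GammaEv]
      exact (neg_mul_mul_neg_eq _ _).symm
    refine ⟨φodd, hgr, himp.2, ?_, fun a => ?_⟩
    · refine smul_left_injective ℂ himp.ne_zero ?_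
      change ε φodd • GammaOdd H = (-1 : ℂ) • GammaOdd H
      rw [← hεU _ hgr _ himp, GammaEv_mul_GammaOdd_mul_GammaEv]
      exact (neg_one_smul ℂ (GammaOdd H)).symm
    · rw [himp.2, himp.2, star_GammaOdd]
      calc _ = (GammaOdd H * GammaOdd H) * a * (GammaOdd H * GammaOdd H) := by
            simp only [mul_assoc]
        _ = a := by rw [GammaOdd_mul_self, one_mul, mul_one]

end
end

section
/- Let H be a nonzero complex Hilbert space. On the product *-algebra A = B(H) × B(H) consider the grading γ(a,b) = (b,a). For a unitary u ∈ B(H) and ε ∈ ℤ/2ℤ define φ_{u,0}(a,b) = (u∘a∘u*, u∘b∘u*) and φ_{u,1}(a,b) = (u∘b∘u*, u∘a∘u*). Then (u,ε) ↦ φ_{u,ε} is a group homomorphism from U(H) × ℤ/2ℤ onto the group of *-algebra automorphisms of A commuting with γ, and its kernel is {(λ·1, 0) : λ ∈ ℂ, |λ| = 1}. In particular, this group of automorphisms is isomorphic to (U(H)/U(1)) × ℤ/2ℤ. -/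
noncomputable section

variable {H : Type*} [NormedAddCommGroup H] [InnerProductSpace ℂ H] [CompleteSpace H]

/-- `Phi u ε` is the map `φ_{u,ε}` on `B(H) × B(H)`: conjugation by `u` in both components,
composed with the swap if `ε = 1`. -/
def Phi (u : unitary (H →L[ℂ] H)) (ε : ZMod 2)
    (x : (H →L[ℂ] H) × (H →L[ℂ] H)) : (H →L[ℂ] H) × (H →L[ℂ] H) :=
  if ε = 0 then ((u : H →L[ℂ] H) * x.1 * star (u : H →L[ℂ] H),
                 (u : H →L[ℂ] H) * x.2 * star (u : H →L[ℂ] H))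
  else ((u : H →L[ℂ] H) * x.2 * star (u : H →L[ℂ] H),
        (u : H →L[ℂ] H) * x.1 * star (u : H →L[ℂ] H))

lemma Phi_zero (u : unitary (H →L[ℂ] H)) (x : (H →L[ℂ] H) × (H →L[ℂ] H)) :
    Phi u 0 x = ((u : H →L[ℂ] H) * x.1 * star (u : H →L[ℂ] H),
      (u : H →L[ℂ] H) * x.2 * star (u : H →L[ℂ] H)) :=
  if_pos rfl

lemma Phi_one (u : unitary (H →L[ℂ] H)) (x : (H →L[ℂ] H) × (H →L[ℂ] H)) :
    Phi u 1 x = ((u : H →L[ℂ] H) * x.2 * star (u : H →L[ℂ] H),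
      (u : H →L[ℂ] H) * x.1 * star (u : H →L[ℂ] H)) :=
  if_neg one_ne_zero

lemma zmod_two_eq_zero_or_one (ε : ZMod 2) : ε = 0 ∨ ε = 1 := by
  revert ε; decide

lemma Phi_mul_add (u v : unitary (H →L[ℂ] H)) (ε δ : ZMod 2)
    (x : (H →L[ℂ] H) × (H →L[ℂ] H)) : Phi (u * v) (ε + δ) x = Phi u ε (Phi v δ x) := by
  have h2 : (1 : ZMod 2) + 1 = 0 := rfl
  rcases zmod_two_eq_zero_or_one ε with rfl | rfl <;>
    rcases zmod_two_eq_zero_or_one δ with rfl | rfl <;>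
    simp [h2, Phi_zero, Phi_one, mul_assoc]

lemma Phi_one_zero (x : (H →L[ℂ] H) × (H →L[ℂ] H)) : Phi 1 0 x = x := by
  simp [Phi_zero]

/-- `Phi u ε` as a ⋆-algebra automorphism. -/
def phiStarAlgEquiv (u : unitary (H →L[ℂ] H)) (ε : ZMod 2) :
    ((H →L[ℂ] H) × (H →L[ℂ] H)) ≃⋆ₐ[ℂ] ((H →L[ℂ] H) × (H →L[ℂ] H)) where
  toFun := Phi u ε
  invFun := Phi (star u) (-ε)
  left_inv x := by rw [← Phi_mul_add]; simp [CharTwo.add_self_eq_zero, Phi_one_zero]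
  right_inv x := by rw [← Phi_mul_add]; simp [CharTwo.add_self_eq_zero, Phi_one_zero]
  map_mul' x y := by
    have h (a b : H →L[ℂ] H) := map_mul (Unitary.conjStarAlgAut ℂ _ u) a b
    simp only [Unitary.conjStarAlgAut_apply] at h
    rcases zmod_two_eq_zero_or_one ε with rfl | rfl <;> simp only [Phi_zero, Phi_one] <;>
      ext1 <;> exact h _ _
  map_add' x y := by
    rcases zmod_two_eq_zero_or_one ε with rfl | rfl <;>
      simp [Phi_zero, Phi_one, mul_add, add_mul]
  map_star' x := by
    rcases zmod_two_eq_zero_or_one ε with rfl | rfl <;> ext1 <;>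
      simp [Phi_zero, Phi_one, mul_assoc]
  map_smul' c x := by
    rcases zmod_two_eq_zero_or_one ε with rfl | rfl <;> simp [Phi_zero, Phi_one]

lemma forall_Phi_eq_self_iff [Nontrivial H] (u : unitary (H →L[ℂ] H)) (ε : ZMod 2) :
    (∀ x, Phi u ε x = x) ↔ (ε = 0 ∧ ∃ l : ℂ, ‖l‖ = 1 ∧ (u : H →L[ℂ] H) = l • 1) := by
  constructor
  · intro h
    rcases zmod_two_eq_zero_or_one ε with rfl | rfl
    · refine ⟨rfl, ?_⟩
      have hu : Unitary.conjStarAlgAut ℂ (H →L[ℂ] H) u = Unitary.conjStarAlgAut ℂ _ 1 := by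
        ext1 a
        simpa [Phi_zero] using congrArg Prod.fst (h (a, a))
      obtain ⟨α, hα⟩ := (Unitary.conjStarAlgAut_ext_iff' u 1).1 hu
      exact ⟨α, CStarRing.norm_coe_unitary α, congrArg Subtype.val hα⟩
    · simpa [Phi_one] using congrArg Prod.fst (h (1, 0))
  · rintro ⟨rfl, l, hl, hu⟩ x
    have h1 : l * starRingEnd ℂ l = 1 := by simp [Complex.mul_conj', hl]
    simp [Phi_zero, hu, smul_smul, mul_comm _ l, h1]

/-- A ⋆-algebra automorphism of `A × A` commuting with the swap restricts to the diagonal. -/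
def diagonalStarAlgEquiv {A : Type*} [Semiring A] [StarRing A] [Algebra ℂ A]
    (ψ : (A × A) ≃⋆ₐ[ℂ] (A × A)) (h : ∀ x, ψ (x.2, x.1) = ((ψ x).2, (ψ x).1)) :
    A ≃⋆ₐ[ℂ] A where
  toFun a := (ψ (a, a)).1
  invFun a := (ψ.symm (a, a)).1
  left_inv a := by
    have : ((ψ (a, a)).1, (ψ (a, a)).1) = ψ (a, a) :=
      Prod.ext rfl (congrArg Prod.fst (h (a, a)))
    simp [this]
  right_inv a := by
    have hs : (ψ.symm (a, a)).1 = (ψ.symm (a, a)).2 := by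
      have hswap : ψ ((ψ.symm (a, a)).2, (ψ.symm (a, a)).1) = ψ (ψ.symm (a, a)) := by
        rw [h, ψ.apply_symm_apply]
      exact (congrArg Prod.fst (ψ.injective hswap)).symm
    have : ((ψ.symm (a, a)).1, (ψ.symm (a, a)).1) = ψ.symm (a, a) := Prod.ext rfl hs
    simp [this]
  map_mul' a b := by rw [← Prod.fst_mul, ← map_mul, Prod.mk_mul_mk]
  map_add' a b := by rw [← Prod.fst_add, ← map_add, Prod.mk_add_mk]
  map_star' a := by rw [← Prod.fst_star, ← map_star]; rfl
  map_smul' c a := by rw [← Prod.smul_fst, ← map_smul, Prod.smul_mk]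

/-- Every ⋆-automorphism of `B(H)` is inner. -/
lemma exists_eq_conjStarAlgAut (f : (H →L[ℂ] H) ≃⋆ₐ[ℂ] (H →L[ℂ] H)) :
    ∃ u : unitary (H →L[ℂ] H), f = Unitary.conjStarAlgAut ℂ _ u := by
  obtain ⟨U, hU⟩ := f.eq_linearIsometryEquivConjStarAlgEquiv
    (StarAlgEquiv.isometry f).continuous
  exact ⟨Unitary.linearIsometryEquiv.symm U, by
    rw [hU, Unitary.conjStarAlgAut_symm_unitaryLinearIsometryEquiv]⟩

/-- The only central idempotents of a central algebra over a field are `0` and `1`. -/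
lemma eq_zero_or_one_of_mul_self_eq_of_central {K A : Type*} [Field K] [Ring A] [Algebra K A]
    [Algebra.IsCentral K A] {p : A} (hp : p * p = p) (hc : ∀ a, a * p = p * a) :
    p = 0 ∨ p = 1 := by
  have hmem : p ∈ Subalgebra.center K A := Subalgebra.mem_center_iff.2 hc
  rw [Algebra.IsCentral.center_eq_bot, Algebra.mem_bot] at hmem
  obtain ⟨c, rfl⟩ := hmem
  rcases subsingleton_or_nontrivial A with _ | _
  · exact Or.inl (Subsingleton.elim _ _)
  · rw [← map_mul, (algebraMap K A).injective.eq_iff] at hp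
    rcases IsIdempotentElem.iff_eq_zero_or_one.1 hp with rfl | rfl <;> simp

lemma exists_eq_Phi
    (ψ : ((H →L[ℂ] H) × (H →L[ℂ] H)) ≃⋆ₐ[ℂ] ((H →L[ℂ] H) × (H →L[ℂ] H)))
    (h : ∀ x, ψ (x.2, x.1) = ((ψ x).2, (ψ x).1)) :
    ∃ (u : unitary (H →L[ℂ] H)) (ε : ZMod 2), ∀ x, ψ x = Phi u ε x := by
  obtain ⟨u, hu⟩ := exists_eq_conjStarAlgAut (diagonalStarAlgEquiv ψ h)
  have hdiag (a : H →L[ℂ] H) : ψ (a, a) = ((u : H →L[ℂ] H) * a * star (u : H →L[ℂ] H),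
      (u : H →L[ℂ] H) * a * star (u : H →L[ℂ] H)) := by
    have h1 : (ψ (a, a)).1 = (u : H →L[ℂ] H) * a * star (u : H →L[ℂ] H) :=
      DFunLike.congr_fun hu a
    exact Prod.ext h1 ((congrArg Prod.fst (h (a, a))).symm.trans h1)
  have hsplit (x : (H →L[ℂ] H) × (H →L[ℂ] H)) :
      ψ x = ψ (x.1, x.1) * ψ (1, 0) + ψ (x.2, x.2) * ψ (0, 1) := by
    rw [← map_mul, ← map_mul, ← map_add]; simp
  have hswap : ψ (0, 1) = ((ψ (1, 0)).2, (ψ (1, 0)).1) := h (1, 0)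
  have hsum : (ψ (1, 0)).1 + (ψ (1, 0)).2 = 1 := by
    have : ψ (1, 0) + ψ (0, 1) = 1 := by
      rw [← map_add, ← map_one ψ]; simp
    rw [hswap] at this
    exact congrArg Prod.fst this
  have hidem : (ψ (1, 0)).1 * (ψ (1, 0)).1 = (ψ (1, 0)).1 := by
    rw [← Prod.fst_mul, ← map_mul]; simp
  have hcentral (a : H →L[ℂ] H) : a * (ψ (1, 0)).1 = (ψ (1, 0)).1 * a := by
    have hcomm : ψ (ψ.symm (a, 0)) * ψ (1, 0) = ψ (1, 0) * ψ (ψ.symm (a, 0)) := by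
      rw [← map_mul, ← map_mul]
      congr 1
      ext1 <;> simp
    rw [ψ.apply_symm_apply] at hcomm
    exact congrArg Prod.fst hcomm
  rcases eq_zero_or_one_of_mul_self_eq_of_central (K := ℂ) hidem hcentral with h0 | h1
  · have h1 : (ψ (1, 0)).2 = 1 := by simpa [h0] using hsum
    have he : ψ (1, 0) = (0, 1) := Prod.ext h0 h1
    refine ⟨u, 1, fun x => ?_⟩
    rw [hsplit, hswap, he, hdiag, hdiag, Phi_one]
    simp
  · have h0 : (ψ (1, 0)).2 = 0 := by simpa [h1] using hsum
    have he : ψ (1, 0) = (1, 0) := Prod.ext h1 h0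
    refine ⟨u, 0, fun x => ?_⟩
    rw [hsplit, hswap, he, hdiag, hdiag, Phi_zero]
    simp

/-- For the swap grading `γ(a,b) = (b,a)` on `B(H) × B(H)` (`H` a nonzero
complex Hilbert space), the assignment `(u,ε) ↦ φ_{u,ε}` is a group homomorphism from
`U(H) × ℤ/2ℤ` onto the group of ⋆-algebra automorphisms commuting with `γ`, whose kernel is
`{(λ·1, 0) : |λ| = 1}`; in particular the latter group is isomorphic to
`(U(H)/U(1)) × ℤ/2ℤ`. -/
theorem stmt_7 [Nontrivial H] :
    (∀ (u : unitary (H →L[ℂ] H)) (ε : ZMod 2),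
      ∃ ψ : ((H →L[ℂ] H) × (H →L[ℂ] H)) ≃⋆ₐ[ℂ] ((H →L[ℂ] H) × (H →L[ℂ] H)),
        (∀ x, ψ (x.2, x.1) = ((ψ x).2, (ψ x).1)) ∧ ∀ x, ψ x = Phi u ε x) ∧
    (∀ (u v : unitary (H →L[ℂ] H)) (ε δ : ZMod 2) (x : (H →L[ℂ] H) × (H →L[ℂ] H)),
      Phi (u * v) (ε + δ) x = Phi u ε (Phi v δ x)) ∧
    (∀ ψ : ((H →L[ℂ] H) × (H →L[ℂ] H)) ≃⋆ₐ[ℂ] ((H →L[ℂ] H) × (H →L[ℂ] H)),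
      (∀ x, ψ (x.2, x.1) = ((ψ x).2, (ψ x).1)) →
      ∃ (u : unitary (H →L[ℂ] H)) (ε : ZMod 2), ∀ x, ψ x = Phi u ε x) ∧
    (∀ (u : unitary (H →L[ℂ] H)) (ε : ZMod 2),
      (∀ x, Phi u ε x = x) ↔
        (ε = 0 ∧ ∃ l : ℂ, ‖l‖ = 1 ∧ (u : H →L[ℂ] H) = l • 1)) := by
  refine ⟨fun u ε => ⟨phiStarAlgEquiv u ε, fun x => ?_, fun _ => rfl⟩, Phi_mul_add,
    exists_eq_Phi, forall_Phi_eq_self_iff⟩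
  change Phi u ε _ = ((Phi u ε x).2, (Phi u ε x).1)
  rcases zmod_two_eq_zero_or_one ε with rfl | rfl <;> simp only [Phi_zero, Phi_one]

end
end
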